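/- The set 𝔤 is a Lie subalgebra of sp(2n,ℝ): every A ∈ 𝔤 satisfies AᵀJ_{2n} + J_{2n}A = 0, 𝔤 is an ℝ-linear subspace of the 2n×2n real matrices, and for all A, A' ∈ 𝔤 the commutator AA' − A'A again lies in 𝔤. -/

import Mathlib

open Matrix

/-- The standard symplectic matrix `J_{2k}`: the `2k × 2k` block-diagonal matrix consisting of
`k` copies of the `2 × 2` block `[[0,-1],[1,0]]`. -/
def Jstd (k : ℕ) : Matrix (Fin (2 * k)) (Fin (2 * k)) ℝ :=
  Matrix.of fun i j =>
    if i.val = j.val + 1 ∧ j.val % 2 = 0 then 1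
    else if j.val = i.val + 1 ∧ i.val % 2 = 0 then -1
    else 0

/-- `J_{2n}` on the index set `Fin (2m) ⊕ Fin 2` (so `2n = 2m + 2`): block diagonal with
`J_{2m}` on the first summand and `[[0,-1],[1,0]]` on the second. -/
def Jsum (m : ℕ) : Matrix (Fin (2 * m) ⊕ Fin 2) (Fin (2 * m) ⊕ Fin 2) ℝ :=
  Matrix.fromBlocks (Jstd m) 0 0 !![0, -1; 1, 0]

/-- The interleaved vector `(X₁, Y₁, …, X_m, Y_m)` in `ℝ^{2m}`. -/
def interleave (m : ℕ) (X Y : Fin m → ℝ) : Fin (2 * m) → ℝ :=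
  fun i =>
    if i.val % 2 = 0 then X ⟨i.val / 2, by have := i.isLt; omega⟩
    else Y ⟨i.val / 2, by have := i.isLt; omega⟩

/-- The `(2m) × 2` block with prescribed first column and zero second column. -/
def colB (m : ℕ) (x : Fin (2 * m) → ℝ) : Matrix (Fin (2 * m)) (Fin 2) ℝ :=
  Matrix.of fun i j => if j = 0 then x i else 0

/-- The `2 × (2m)` block with zero first row and prescribed second row. -/
def rowC (m : ℕ) (w : Fin (2 * m) → ℝ) : Matrix (Fin 2) (Fin (2 * m)) ℝ :=
  Matrix.of fun i j => if i = 1 then w j else 0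

/-- The set `𝔤` of block matrices `[[R,B],[C,D]]` with `R ∈ sp(2m, ℝ)`, `B` having first
column `(X₁,Y₁,…,X_m,Y_m)ᵀ` and second column `0`, `C` having first row `0` and second row
`(Y₁,−X₁,…,Y_m,−X_m)`, and `D = [[a,0],[b,−a]]`. -/
def gSet (m : ℕ) : Set (Matrix (Fin (2 * m) ⊕ Fin 2) (Fin (2 * m) ⊕ Fin 2) ℝ) :=
  { A | ∃ (R : Matrix (Fin (2 * m)) (Fin (2 * m)) ℝ) (X Y : Fin m → ℝ) (a b : ℝ),
      Rᵀ * Jstd m + Jstd m * R = 0 ∧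
      A = Matrix.fromBlocks R (colB m (interleave m X Y))
            (rowC m (interleave m Y fun t => -X t)) !![a, 0; b, -a] }

lemma Jstd_mulVec (m : ℕ) (X Y : Fin m → ℝ) :
    Jstd m *ᵥ interleave m X Y = - interleave m Y (fun t => -X t) := by
  ext i
  have hi := i.isLt
  simp only [Matrix.mulVec, dotProduct, Pi.neg_apply]
  rcases Nat.mod_two_eq_zero_or_one i.val with h | h
  · rw [Finset.sum_eq_single (⟨i.val + 1, by omega⟩ : Fin (2 * m))]
    · have h1 : (i.val + 1) % 2 = 1 := by omega
      have h2 : (i.val + 1) / 2 = i.val / 2 := by omega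
      have h3 : ¬ (i.val = i.val + 1 + 1) := by omega
      simp [Jstd, interleave, h, h1, h2, h3]
    · intro j _ hj
      have hj' : j.val ≠ i.val + 1 := fun hh => hj (Fin.ext hh)
      have h4 : ¬ (i.val = j.val + 1 ∧ j.val % 2 = 0) := by omega
      simp [Jstd, h4, hj']
    · simp
  · rw [Finset.sum_eq_single (⟨i.val - 1, by omega⟩ : Fin (2 * m))]
    · have h1 : (i.val - 1) % 2 = 0 := by omega
      have h2 : (i.val - 1) / 2 = i.val / 2 := by omega
      have h3 : i.val = i.val - 1 + 1 := by omega
      simp [Jstd, interleave, h, h1, h2, ← h3]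
    · intro j _ hj
      have hj' : j.val ≠ i.val - 1 := fun hh => hj (Fin.ext hh)
      have h4 : ¬ (i.val = j.val + 1 ∧ j.val % 2 = 0) := by omega
      simp [Jstd, h4, h]
    · simp

lemma exists_interleave (m : ℕ) (v : Fin (2 * m) → ℝ) :
    ∃ X Y : Fin m → ℝ, v = interleave m X Y := by
  refine ⟨fun t => v ⟨2 * t.val, by omega⟩, fun t => v ⟨2 * t.val + 1, by omega⟩, ?_⟩
  ext i
  unfold interleave
  split_ifs with h
  · exact congrArg v (Fin.ext (by simp; omega))
  · exact congrArg v (Fin.ext (by simp; omega))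

lemma Jstd_mul_apply (m : ℕ) (B : Matrix (Fin (2 * m)) (Fin 2) ℝ) (i : Fin (2 * m)) (j : Fin 2) :
    (Jstd m * B) i j = (Jstd m *ᵥ (fun k => B k j)) i := rfl

lemma Jstd_transpose (m : ℕ) : (Jstd m)ᵀ = - Jstd m := by
  ext i j
  simp only [Jstd, Matrix.transpose_apply, Matrix.of_apply, Matrix.neg_apply]
  split_ifs <;> first | omega | simp

/-- `𝔤` is the stabilizer in `sp` of the line spanned by the last basis vector. -/
lemma mem_gSet_iff (m : ℕ) (A : Matrix (Fin (2 * m) ⊕ Fin 2) (Fin (2 * m) ⊕ Fin 2) ℝ) :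
    A ∈ gSet m ↔ (Aᵀ * Jsum m + Jsum m * A = 0 ∧ ∀ i, i ≠ Sum.inr 1 → A i (Sum.inr 1) = 0) := by
  constructor
  · rintro ⟨R, X, Y, a, b, hR, rfl⟩
    have key : (rowC m (interleave m Y fun t => -X t))ᵀ * (!![0, -1; 1, 0] : Matrix (Fin 2) (Fin 2) ℝ)
        + Jstd m * colB m (interleave m X Y) = 0 := by
      ext i j
      have h0 := congrFun (Jstd_mulVec m X Y) i
      rw [Matrix.add_apply, Jstd_mul_apply]
      fin_cases j
      · simp [Matrix.mul_apply, rowC, colB, h0]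
      · simp [Matrix.mul_apply, rowC, colB, Matrix.mulVec, dotProduct]
    have key2 : (colB m (interleave m X Y))ᵀ * Jstd m
        + (!![0, -1; 1, 0] : Matrix (Fin 2) (Fin 2) ℝ) * rowC m (interleave m Y fun t => -X t) = 0 := by
      have h := congrArg Matrix.transpose key
      rw [Matrix.transpose_add, Matrix.transpose_mul, Matrix.transpose_mul, Jstd_transpose,
        Matrix.transpose_transpose, Matrix.transpose_zero] at h
      have hJ : (!![0, -1; 1, 0] : Matrix (Fin 2) (Fin 2) ℝ)ᵀ = - !![0, -1; 1, 0] := by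
        ext i j; fin_cases i <;> fin_cases j <;> simp
      rw [hJ, Matrix.neg_mul, Matrix.mul_neg, ← neg_add, neg_eq_zero, add_comm] at h
      exact h
    refine ⟨?_, ?_⟩
    · rw [Jsum, Matrix.fromBlocks_transpose, Matrix.fromBlocks_multiply,
        Matrix.fromBlocks_multiply, Matrix.fromBlocks_add]
      simp only [Matrix.mul_zero, Matrix.zero_mul, add_zero, zero_add]
      rw [hR, key, key2, ← Matrix.fromBlocks_zero]
      congr 1
      ext i j
      fin_cases i <;> fin_cases j <;> simp [Matrix.mul_apply]
    · rintro (i | i) hi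
      · simp [colB]
      · fin_cases i
        · simp
        · simp at hi
  · rintro ⟨h, hz⟩
    obtain ⟨R, B, C, D, rfl⟩ : ∃ R B C D, A = Matrix.fromBlocks R B C D :=
      ⟨_, _, _, _, (Matrix.fromBlocks_toBlocks A).symm⟩
    rw [Jsum, Matrix.fromBlocks_transpose, Matrix.fromBlocks_multiply,
        Matrix.fromBlocks_multiply, Matrix.fromBlocks_add, ← Matrix.fromBlocks_zero,
        Matrix.fromBlocks_inj] at h
    simp only [Matrix.mul_zero, Matrix.zero_mul, add_zero, zero_add] at h
    obtain ⟨h1, h2, -, h4⟩ := h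
    have hB : ∀ i, B i 1 = 0 := fun i => by simpa using hz (Sum.inl i) (by simp)
    have hD : D 0 1 = 0 := by simpa using hz (Sum.inr 0) (by simp)
    obtain ⟨X, Y, hXY⟩ := exists_interleave m (fun i => B i 0)
    refine ⟨R, X, Y, D 0 0, D 1 0, h1, ?_⟩
    rw [Matrix.fromBlocks_inj]
    refine ⟨rfl, ?_, ?_, ?_⟩
    · ext i j
      fin_cases j
      · simpa [colB] using congrFun hXY i
      · simp [colB, hB]
    · ext i j
      fin_cases i
      · have := congrFun (congrFun h2 j) 1
        rw [Matrix.add_apply, Jstd_mul_apply] at this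
        simpa [Matrix.mul_apply, hB, Matrix.mulVec, dotProduct, rowC] using this
      · have := congrFun (congrFun h2 j) 0
        rw [Matrix.add_apply, Jstd_mul_apply, hXY, Jstd_mulVec] at this
        simp [Matrix.mul_apply, Matrix.vecMul, dotProduct] at this
        simp [rowC]
        linarith
    · have := congrFun (congrFun h4 0) 1
      simp [Matrix.mul_apply, Matrix.vecMul, dotProduct] at this
      ext i j
      fin_cases i <;> fin_cases j <;> simp [hD]
      linarith

/-- `𝔤` is a Lie subalgebra of `sp(2n, ℝ)`: every `A ∈ 𝔤` satisfies
`Aᵀ J_{2n} + J_{2n} A = 0`, `𝔤` is an `ℝ`-linear subspace, and `𝔤` is closed under the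
matrix commutator. Here `2n = 2(n-1) + 2` and `n ≥ 2`. -/
theorem g_is_lie_subalgebra_of_sp (n : ℕ) (hn : 2 ≤ n) :
    (∀ A ∈ gSet (n - 1), Aᵀ * Jsum (n - 1) + Jsum (n - 1) * A = 0) ∧
    ((0 : Matrix (Fin (2 * (n - 1)) ⊕ Fin 2) (Fin (2 * (n - 1)) ⊕ Fin 2) ℝ) ∈ gSet (n - 1)) ∧
    (∀ A ∈ gSet (n - 1), ∀ A' ∈ gSet (n - 1), A + A' ∈ gSet (n - 1)) ∧
    (∀ (c : ℝ), ∀ A ∈ gSet (n - 1), c • A ∈ gSet (n - 1)) ∧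
    (∀ A ∈ gSet (n - 1), ∀ A' ∈ gSet (n - 1), A * A' - A' * A ∈ gSet (n - 1)) := by
  simp only [mem_gSet_iff]
  generalize n - 1 = m
  generalize Jsum m = J
  refine ⟨fun A h => h.1, ⟨by simp, by simp⟩, ?_, ?_, ?_⟩
  · rintro A ⟨h, hz⟩ A' ⟨h', hz'⟩
    refine ⟨?_, fun i hi => by simp [hz i hi, hz' i hi]⟩
    have e : (A + A')ᵀ * J + J * (A + A') = (Aᵀ * J + J * A) + (A'ᵀ * J + J * A') := by
      rw [Matrix.transpose_add]; noncomm_ring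
    rw [e, h, h', add_zero]
  · rintro c A ⟨h, hz⟩
    refine ⟨?_, fun i hi => by simp [hz i hi]⟩
    rw [Matrix.transpose_smul, Matrix.smul_mul, Matrix.mul_smul, ← smul_add, h, smul_zero]
  · rintro A ⟨h, hz⟩ A' ⟨h', hz'⟩
    refine ⟨?_, fun i hi => ?_⟩
    · have e : (A * A' - A' * A)ᵀ * J + J * (A * A' - A' * A)
          = A'ᵀ * (Aᵀ * J + J * A) - (A'ᵀ * J + J * A') * A
            - Aᵀ * (A'ᵀ * J + J * A') + (Aᵀ * J + J * A) * A' := by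
        rw [Matrix.transpose_sub, Matrix.transpose_mul, Matrix.transpose_mul]; noncomm_ring
      rw [e, h, h']; simp
    · rw [Matrix.sub_apply, Matrix.mul_apply, Matrix.mul_apply,
        Finset.sum_eq_single (Sum.inr 1), Finset.sum_eq_single (Sum.inr 1), hz i hi, hz' i hi]
      · simp
      · intro k _ hk; rw [hz k hk, mul_zero]
      · simp
      · intro k _ hk; rw [hz' k hk, mul_zero]
      · simp
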